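/- arXiv:2411.09060 — 5 statements merged into one kernel-verified Lean document; each statement's English description precedes it below -/
import Mathlib

section
/- The set of triples (n, b, m) of integers with n ≥ 2, b ≥ 2, m ≥ 6 and n! = (b^m − 1)/(b − 1) − 1 is finite. -/
open ArithmeticFunction Finset

/-- The von Mangoldt function restricted to integers congruent to `1` modulo `Q`. -/
noncomputable def vonMangoldtOne (Q : ℕ) : ArithmeticFunction ℝ :=
  ⟨fun m => if m ≡ 1 [MOD Q] then vonMangoldt m else 0, by simp⟩

theorem vonMangoldtOne_apply (Q m : ℕ) :
    vonMangoldtOne Q m = if m ≡ 1 [MOD Q] then vonMangoldt m else 0 := rfl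

theorem vonMangoldtOne_nonneg (Q m : ℕ) : 0 ≤ vonMangoldtOne Q m := by
  rw [vonMangoldtOne_apply]
  split_ifs
  · exact vonMangoldt_nonneg
  · exact le_rfl

/-- The Chebyshev function `ψ(x; Q, 1)`. -/
noncomputable def psiOne (Q x : ℕ) : ℝ := ∑ m ∈ Ioc 0 x, vonMangoldtOne Q m

theorem psiOne_mono (Q : ℕ) : Monotone (psiOne Q) := fun _ _ h =>
  sum_le_sum_of_subset_of_nonneg (Ioc_subset_Ioc_right h) fun _ _ _ => vonMangoldtOne_nonneg _ _

theorem psiOne_nonneg (Q x : ℕ) : 0 ≤ psiOne Q x :=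
  sum_nonneg fun _ _ => vonMangoldtOne_nonneg _ _

theorem psiOne_eq_zero {Q x : ℕ} (h : x ≤ Q) : psiOne Q x = 0 := by
  refine sum_eq_zero fun m hm => ?_
  rw [mem_Ioc] at hm
  rw [vonMangoldtOne_apply]
  split_ifs with h1
  · have h2 : Q ∣ m - 1 := (Nat.modEq_iff_dvd' hm.1).mp h1.symm
    have h3 : m - 1 = 0 := Nat.eq_zero_of_dvd_of_lt h2 (by omega)
    rw [show m = 1 by omega, vonMangoldt_apply_one]
  · rfl

theorem log_factorial_eq_sum_vonMangoldt (K : ℕ) :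
    Real.log (K.factorial : ℝ) = ∑ m ∈ Ioc 0 K, vonMangoldt m * ((K / m : ℕ) : ℝ) := by
  rw [← sum_Ioc_mul_zeta_eq_sum, vonMangoldt_mul_zeta]
  induction K with
  | zero => simp
  | succ K ih =>
    rw [Nat.factorial_succ, Nat.cast_mul, Real.log_mul (by positivity) (by positivity), ih,
      Finset.sum_Ioc_succ_top (Nat.zero_le K), log_apply, add_comm]

theorem log_le_sum_of_dvd_factorial {Q n G : ℕ} (hG : ∀ d, d ∣ G → d ≡ 1 [MOD Q])
    (hdvd : G ∣ n.factorial) :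
    Real.log G ≤ ∑ k ∈ Ioc 0 n, psiOne Q (n / k) := by
  have key : ∑ k ∈ Ioc 0 n, psiOne Q (n / k) =
      ∑ N ∈ Ioc 0 n, ∑ d ∈ N.divisors, vonMangoldtOne Q d := by
    have h := sum_Ioc_mul_eq_sum_sum (zeta : ArithmeticFunction ℝ) (vonMangoldtOne Q) n
    simp only [coe_zeta_mul_apply] at h
    rw [h]
    refine sum_congr rfl fun k hk => ?_
    rw [mem_Ioc] at hk
    simp [psiOne, hk.1.ne']
  rw [key]
  clear key
  induction n generalizing G with
  | zero =>
    have : G = 1 := by simpa using hdvd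
    simp [this]
  | succ n ih =>
    rw [Nat.factorial_succ] at hdvd
    obtain ⟨g, h, hg, hh, rfl⟩ := exists_dvd_and_dvd_of_dvd_mul hdvd
    have hg0 : g ≠ 0 := ne_zero_of_dvd_ne_zero (Nat.succ_ne_zero n) hg
    have hh0 : h ≠ 0 := ne_zero_of_dvd_ne_zero (Nat.factorial_ne_zero n) hh
    rw [Nat.cast_mul, Real.log_mul (mod_cast hg0) (mod_cast hh0),
      Finset.sum_Ioc_succ_top (Nat.zero_le n), add_comm]
    refine add_le_add (ih (fun d hd => hG d (hd.mul_left g)) hh) ?_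
    rw [← vonMangoldt_sum]
    calc ∑ i ∈ g.divisors, vonMangoldt i = ∑ i ∈ g.divisors, vonMangoldtOne Q i := by
          refine sum_congr rfl fun i hi => ?_
          rw [vonMangoldtOne_apply, if_pos (hG i ((Nat.dvd_of_mem_divisors hi).mul_right h))]
      _ ≤ _ := sum_le_sum_of_subset_of_nonneg (Nat.divisors_subset_of_dvd n.succ_ne_zero hg)
          fun _ _ _ => vonMangoldtOne_nonneg _ _

/-- The logarithm of `∏ p ^ (1 / (p - 1))` over the primes `p` dividing `Q`. -/
noncomputable def ramifiedLog (Q : ℕ) : ℝ := ∑ p ∈ Q.primeFactors, Real.log p / (p - 1)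

theorem ramifiedLog_nonneg (Q : ℕ) : 0 ≤ ramifiedLog Q := by
  refine sum_nonneg fun p hp => div_nonneg (Real.log_natCast_nonneg p) ?_
  have : (1 : ℝ) ≤ p := mod_cast (Nat.prime_of_mem_primeFactors hp).one_le
  linarith

theorem sum_not_coprime_le {Q : ℕ} (hQ : Q ≠ 0) (K : ℕ) :
    ∑ m ∈ Ioc 0 K with ¬ m.Coprime Q, vonMangoldt m * ((K / m : ℕ) : ℝ) ≤ K * ramifiedLog Q := by
  set f : ℕ → ℝ := fun m => vonMangoldt m * ((K / m : ℕ) : ℝ) with hf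
  have hf0 : ∀ m, 0 ≤ f m := fun m => mul_nonneg vonMangoldt_nonneg (Nat.cast_nonneg _)
  have hsub : {m ∈ Ioc 0 K | ¬ m.Coprime Q ∧ IsPrimePow m} ⊆
      (Q.primeFactors ×ˢ Ico 1 (K + 1)).image fun x => x.1 ^ x.2 := by
    intro m hm
    simp only [mem_filter, mem_Ioc] at hm
    obtain ⟨⟨hm0, hmK⟩, hc, hpp⟩ := hm
    obtain ⟨p, j, hp, hj, rfl⟩ := (isPrimePow_nat_iff m).mp hpp
    have hpQ : p ∣ Q := by
      by_contra h
      exact hc (Nat.Coprime.pow_left j ((Nat.Prime.coprime_iff_not_dvd hp).mpr h))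
    simp only [mem_image, mem_product, Prod.exists, mem_Ico]
    refine ⟨p, j, ⟨Nat.mem_primeFactors.mpr ⟨hp, hpQ, hQ⟩, hj, ?_⟩, rfl⟩
    have := Nat.lt_pow_self hp.one_lt (n := j)
    omega
  calc ∑ m ∈ Ioc 0 K with ¬ m.Coprime Q, f m
      = ∑ m ∈ Ioc 0 K with ¬ m.Coprime Q ∧ IsPrimePow m, f m := by
        rw [← filter_filter]
        refine (sum_filter_of_ne fun m _ hm => ?_).symm
        exact vonMangoldt_ne_zero_iff.mp (left_ne_zero_of_mul hm)
    _ ≤ ∑ m ∈ (Q.primeFactors ×ˢ Ico 1 (K + 1)).image fun x => x.1 ^ x.2, f m :=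
        sum_le_sum_of_subset_of_nonneg hsub fun _ _ _ => hf0 _
    _ ≤ ∑ x ∈ Q.primeFactors ×ˢ Ico 1 (K + 1), f (x.1 ^ x.2) :=
        sum_image_le_of_nonneg fun _ _ => hf0 _
    _ = ∑ p ∈ Q.primeFactors, ∑ j ∈ Ico 1 (K + 1), f (p ^ j) := sum_product _ _ _
    _ ≤ ∑ p ∈ Q.primeFactors, K * (Real.log p / (p - 1)) := by
        refine sum_le_sum fun p hp => ?_
        have hp := Nat.prime_of_mem_primeFactors hp
        have h1 : ∀ j ∈ Ico 1 (K + 1), f (p ^ j) = Real.log p * ((K / p ^ j : ℕ) : ℝ) := by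
          intro j hj
          rw [mem_Ico] at hj
          simp only [hf]
          rw [vonMangoldt_apply_pow (by omega), vonMangoldt_apply_prime hp]
        rw [sum_congr rfl h1, ← mul_sum, ← Nat.cast_sum]
        have h2 : ((∑ j ∈ Ico 1 (K + 1), K / p ^ j : ℕ) : ℝ) ≤ K / (p - 1) := by
          refine (Nat.cast_le.mpr (Nat.geom_sum_Ico_le hp.two_le K (K + 1))).trans ?_
          refine Nat.cast_div_le.trans ?_
          rw [Nat.cast_sub hp.one_le, Nat.cast_one]
        calc _ ≤ Real.log p * (K / (p - 1)) :=
              mul_le_mul_of_nonneg_left h2 (Real.log_natCast_nonneg p)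
          _ = _ := by ring
    _ = K * ramifiedLog Q := by rw [ramifiedLog, mul_sum]

theorem div_le_card_dvd {m Q : ℕ} (hm : 0 < m) (h : m.Coprime Q) (K : ℕ) :
    K / m ≤ #{j ∈ range K | m ∣ j * Q + 1} := by
  obtain ⟨v, hv⟩ : ∃ v : ℕ, m ∣ v * Q + 1 := by
    have : NeZero m := ⟨hm.ne'⟩
    refine ⟨(-(Q : ZMod m)⁻¹).val, ?_⟩
    rw [← ZMod.natCast_eq_zero_iff]
    push_cast
    rw [ZMod.natCast_zmod_val, neg_mul, mul_comm, ZMod.coe_mul_inv_eq_one Q h.symm]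
    ring
  calc K / m ≤ K.count (· ≡ v [MOD m]) := by
        rw [Nat.count_modEq_card K hm v]
        exact Nat.le_add_right _ _
    _ = #{j ∈ range K | j ≡ v [MOD m]} := Nat.count_eq_card_filter_range _ _
    _ ≤ _ := by
        refine card_le_card fun j hj => ?_
        rw [mem_filter] at hj ⊢
        exact ⟨hj.1, ((hj.2.mul_right Q).add_right 1).dvd_iff dvd_rfl |>.mpr hv⟩

theorem sum_log_le (Q k : ℕ) (hQ : 0 < Q) :
    ∑ j ∈ range (k + 1), Real.log ((j * Q + 1 : ℕ) : ℝ) ≤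
      Real.log ((k + 1).factorial : ℝ) + k * Real.log Q := by
  induction k with
  | zero => simp
  | succ k ih =>
    rw [sum_range_succ, Nat.factorial_succ (k + 1), Nat.cast_mul,
      Real.log_mul (by positivity) (by positivity)]
    have : Real.log (((k + 1) * Q + 1 : ℕ) : ℝ) ≤ Real.log ((k + 1 + 1 : ℕ) : ℝ) + Real.log Q := by
      rw [← Real.log_mul (by positivity) (by positivity)]
      refine Real.log_le_log (by positivity) ?_
      norm_cast
      nlinarith
    push_cast at this ih ⊢
    linarith

theorem sum_log_eq (Q k : ℕ) :
    ∑ j ∈ range (k + 1), Real.log ((j * Q + 1 : ℕ) : ℝ) =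
      ∑ m ∈ Ioc 0 (k * Q + 1),
        vonMangoldt m * (#{j ∈ range (k + 1) | m ∣ j * Q + 1} : ℝ) := by
  calc _ = ∑ j ∈ range (k + 1), ∑ m ∈ Ioc 0 (k * Q + 1),
        if m ∣ j * Q + 1 then vonMangoldt m else 0 := by
        refine sum_congr rfl fun j hj => ?_
        rw [← vonMangoldt_sum, ← sum_filter]
        refine sum_congr ?_ fun _ _ => rfl
        ext m
        simp only [Nat.mem_divisors, mem_filter, mem_Ioc]
        constructor
        · rintro ⟨h, -⟩
          have hjk : j * Q ≤ k * Q := Nat.mul_le_mul_right Q (by rw [mem_range] at hj; omega)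
          have := Nat.le_of_dvd (Nat.succ_pos _) h
          exact ⟨⟨Nat.pos_of_dvd_of_pos h (Nat.succ_pos _), by omega⟩, h⟩
        · rintro ⟨-, h⟩
          exact ⟨h, Nat.succ_ne_zero _⟩
    _ = _ := by
        rw [sum_comm]
        refine sum_congr rfl fun m _ => ?_
        rw [← sum_filter, sum_const, nsmul_eq_mul, mul_comm]

theorem psiOne_le_add {Q : ℕ} (hQ : 2 ≤ Q) (k : ℕ) :
    psiOne Q (k * Q + 1) ≤
      psiOne Q (k + 1) + k * Real.log Q + (k + 1) * ramifiedLog Q := by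
  have hK : k + 1 ≤ k * Q + 1 := by nlinarith
  have extend : ∀ f : ℕ → ℝ, ∑ m ∈ Ioc 0 (k + 1), f m =
      ∑ m ∈ Ioc 0 (k * Q + 1), if m ≤ k + 1 then f m else 0 := by
    intro f
    rw [← sum_filter]
    refine sum_congr ?_ fun _ _ => rfl
    ext m
    simp only [mem_filter, mem_Ioc]
    omega
  have h1 := sum_log_le Q k (by omega)
  rw [sum_log_eq Q k, log_factorial_eq_sum_vonMangoldt] at h1
  have h2 := sum_not_coprime_le (show Q ≠ 0 by omega) (k + 1)
  rw [sum_filter, extend] at h2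
  rw [extend] at h1
  have h3 : psiOne Q (k * Q + 1) + ∑ m ∈ Ioc 0 (k * Q + 1),
        (if m ≤ k + 1 then vonMangoldt m * (((k + 1) / m : ℕ) : ℝ) else 0) ≤
      psiOne Q (k + 1) + ∑ m ∈ Ioc 0 (k * Q + 1),
        vonMangoldt m * (#{j ∈ range (k + 1) | m ∣ j * Q + 1} : ℝ) +
      ∑ m ∈ Ioc 0 (k * Q + 1), (if m ≤ k + 1 then
        (if ¬ m.Coprime Q then vonMangoldt m * (((k + 1) / m : ℕ) : ℝ) else 0) else 0) := by
    rw [psiOne, psiOne, extend, ← sum_add_distrib, ← sum_add_distrib, ← sum_add_distrib]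
    refine sum_le_sum fun m hm => ?_
    rw [mem_Ioc] at hm
    have hL : 0 ≤ vonMangoldt m := vonMangoldt_nonneg
    have hcard : (0 : ℝ) ≤ (#{j ∈ range (k + 1) | m ∣ j * Q + 1} : ℝ) := Nat.cast_nonneg _
    rw [vonMangoldtOne_apply]
    by_cases hmk : m ≤ k + 1
    · simp only [hmk, if_true]
      by_cases hc : m.Coprime Q
      · have := mul_le_mul_of_nonneg_left
          (Nat.cast_le (α := ℝ).mpr (div_le_card_dvd hm.1 hc (k + 1))) hL
        rw [if_neg (not_not.mpr hc)]
        linarith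
      · rw [if_pos hc]
        have := mul_nonneg hL hcard
        linarith
    · simp only [hmk, if_false, add_zero, zero_add]
      split_ifs with h
      · have hdvd : Q ∣ m - 1 := (Nat.modEq_iff_dvd' hm.1).mp h.symm
        obtain ⟨j, hj⟩ := hdvd
        have hmj : m = j * Q + 1 := by rw [mul_comm] at hj; omega
        have hjk : j ≤ k := by
          refine Nat.le_of_mul_le_mul_right (c := Q) ?_ (by omega)
          omega
        have : 1 ≤ #{j ∈ range (k + 1) | m ∣ j * Q + 1} := by
          refine Finset.card_pos.mpr ⟨j, ?_⟩
          rw [mem_filter, mem_range, hmj]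
          exact ⟨by omega, dvd_rfl⟩
        exact le_mul_of_one_le_right hL (mod_cast this)
      · exact mul_nonneg hL hcard
  push_cast at h2
  linarith

/-- Chebyshev's upper bound for `ψ(x; Q, 1)`, with an explicit linear coefficient. -/
theorem psiOne_le {Q k₀ : ℕ} (hQ : 2 ≤ Q) (hk₀ : 0 < k₀) {α : ℝ} (hα : 0 ≤ α)
    (h : Real.log Q + (1 + 1 / k₀) * ramifiedLog Q ≤ α * (Q - 1)) {x : ℕ} (hx : 0 < x) :
    psiOne Q x ≤ α * (x - 1) + psiOne Q (k₀ * Q) := by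
  induction x using Nat.strong_induction_on with
  | _ x ih =>
  have hx1 : (1 : ℝ) ≤ x := mod_cast hx
  by_cases hxk : x ≤ k₀ * Q
  · have := psiOne_mono Q hxk
    nlinarith
  obtain ⟨k, hk⟩ : ∃ k, k = (x - 1) / Q := ⟨_, rfl⟩
  have hkQ : k * Q ≤ x - 1 := by rw [hk]; exact Nat.div_mul_le_self _ _
  have hxQ : x - 1 < (k + 1) * Q := by
    rw [hk, add_mul, one_mul]; exact Nat.lt_div_mul_add (by omega)
  have hkk : k₀ ≤ k := by
    rw [hk, Nat.le_div_iff_mul_le (by omega)]; omega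
  have hlt : k + 1 < x := by nlinarith [Nat.sub_add_cancel hx]
  have heq : psiOne Q x = psiOne Q (k * Q + 1) := by
    refine (sum_subset (Ioc_subset_Ioc_right (by omega)) fun m hm hm' => ?_).symm
    rw [vonMangoldtOne_apply, if_neg]
    intro hmod
    rw [mem_Ioc] at hm hm'
    obtain ⟨j, hj⟩ := (Nat.modEq_iff_dvd' (by omega)).mp hmod.symm
    have h1 : k * Q < j * Q := by rw [mul_comm j]; omega
    have h2 : j * Q < (k + 1) * Q := by rw [mul_comm j]; omega
    have h3 := lt_of_mul_lt_mul_right h1 (Nat.zero_le _)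
    have h4 := lt_of_mul_lt_mul_right h2 (Nat.zero_le _)
    omega
  have hrec := psiOne_le_add hQ k
  have hih := ih (k + 1) hlt (Nat.succ_pos k)
  have hS := ramifiedLog_nonneg Q
  have hk₀' : (0 : ℝ) < k₀ := mod_cast hk₀
  have hfrac : ramifiedLog Q ≤ k * (1 / k₀ * ramifiedLog Q) := by
    rw [← mul_assoc]
    refine le_mul_of_one_le_left hS ?_
    rw [mul_one_div, one_le_div hk₀']
    exact mod_cast hkk
  have hmul := mul_le_mul_of_nonneg_left h (Nat.cast_nonneg (α := ℝ) k)
  have hxcast : (k : ℝ) * Q ≤ x - 1 := by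
    have : ((k * Q + 1 : ℕ) : ℝ) ≤ x := Nat.cast_le.mpr (by omega)
    push_cast at this
    linarith
  have hαx := mul_le_mul_of_nonneg_left hxcast hα
  rw [heq]
  push_cast at hih
  linarith

theorem log_le_of_dvd_factorial {Q k₀ : ℕ} (hQ : 2 ≤ Q) (hk₀ : 0 < k₀) {α : ℝ} (hα : 0 ≤ α)
    (h : Real.log Q + (1 + 1 / k₀) * ramifiedLog Q ≤ α * (Q - 1)) {n G : ℕ}
    (hG : ∀ d, d ∣ G → d ≡ 1 [MOD Q]) (hdvd : G ∣ n.factorial) :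
    Real.log G ≤ α * (n * (1 + Real.log n)) + n * psiOne Q (k₀ * Q) := by
  calc Real.log G ≤ ∑ k ∈ Ioc 0 n, psiOne Q (n / k) := log_le_sum_of_dvd_factorial hG hdvd
    _ ≤ ∑ k ∈ Ioc 0 n, (α * n * (k : ℝ)⁻¹ + psiOne Q (k₀ * Q)) := by
        refine sum_le_sum fun k hk => ?_
        rw [mem_Ioc] at hk
        refine (psiOne_le hQ hk₀ hα h (Nat.div_pos hk.2 hk.1)).trans ?_
        have h1 : ((n / k : ℕ) : ℝ) ≤ n / k := Nat.cast_div_le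
        have h2 := mul_le_mul_of_nonneg_left h1 hα
        rw [div_eq_mul_inv] at h2
        linarith
    _ = α * n * ((harmonic n : ℚ) : ℝ) + n * psiOne Q (k₀ * Q) := by
        rw [sum_add_distrib, ← mul_sum, harmonic_eq_sum_Icc, sum_const, Nat.card_Ioc, nsmul_eq_mul,
          Nat.sub_zero]
        push_cast
        rfl
    _ ≤ _ := by
        have := mul_le_mul_of_nonneg_left (harmonic_le_one_add_log n)
          (mul_nonneg hα (Nat.cast_nonneg (α := ℝ) n))
        linarith

theorem modEq_one_of_dvd {Q G : ℕ} (hG : ∀ p, p.Prime → p ∣ G → p ≡ 1 [MOD Q]) (hG0 : G ≠ 0)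
    (d : ℕ) (hd : d ∣ G) : d ≡ 1 [MOD Q] := by
  induction d using Nat.recOnMul with
  | zero => exact absurd (zero_dvd_iff.mp hd) hG0
  | one => rfl
  | prime p hp => exact hG p hp hd
  | mul a b ha hb =>
    simpa using (ha (dvd_of_mul_right_dvd hd)).mul (hb (dvd_of_mul_left_dvd hd))

theorem exists_factor_modEq_one {r Q G : ℕ} (hG0 : G ≠ 0) (hsq : ¬ r ^ 2 ∣ G)
    (h : ∀ p, p.Prime → p ∣ G → p ≠ r → p ≡ 1 [MOD Q]) :
    ∃ g, (∀ d, d ∣ g → d ≡ 1 [MOD Q]) ∧ g ∣ G ∧ (G = g ∨ G = r * g) := by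
  by_cases hr : r ∣ G
  · obtain ⟨g, rfl⟩ := hr
    have hrg : ¬ r ∣ g := fun hrg => hsq (by rw [sq]; exact mul_dvd_mul_left r hrg)
    refine ⟨g, modEq_one_of_dvd (fun p hp hpg => ?_) (right_ne_zero_of_mul hG0),
      dvd_mul_left g r, Or.inr rfl⟩
    exact h p hp (hpg.mul_left r) fun hpr => hrg (hpr ▸ hpg)
  · refine ⟨G, modEq_one_of_dvd (fun p hp hpG => ?_) hG0, dvd_rfl, Or.inl rfl⟩
    exact h p hp hpG fun hpr => hr (hpr ▸ hpG)

theorem log_le_of_log_factorial_le {n : ℕ} (hn : 2 ≤ n) {β γ : ℝ} (hγ : γ < 1)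
    (h : Real.log n.factorial ≤ Real.log 2 + 2 * Real.log n + γ * (n * (1 + Real.log n)) +
      2 * (n * β)) :
    Real.log n ≤ (5 + 2 * β) / (1 - γ) := by
  have hn0 : (0 : ℝ) < n := by positivity
  have hn2 : (2 : ℝ) ≤ n := mod_cast hn
  have h1 := Stirling.le_log_factorial_stirling (show n ≠ 0 by omega)
  have h2 : Real.log 2 ≤ Real.log n := Real.log_le_log (by norm_num) hn2
  have h3 : Real.log n ≤ n - 1 := Real.log_le_sub_one_of_pos hn0
  have h4 : 0 ≤ Real.log (2 * Real.pi) :=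
    Real.log_nonneg (by nlinarith [Real.pi_gt_three])
  have h5 : 0 ≤ Real.log n := Real.log_natCast_nonneg n
  rw [le_div_iff₀ (by linarith)]
  refine le_of_mul_le_mul_left ?_ hn0
  nlinarith

theorem geom_sum_le (b M : ℕ) (hb : 2 ≤ b) : b * ∑ i ∈ range M, b ^ i ≤ 2 * b ^ M := by
  induction M with
  | zero => simp
  | succ M ih =>
    rw [sum_range_succ, mul_add, pow_succ]
    nlinarith [Nat.zero_le (b ^ M)]

theorem geom_sum_mul_eq (b r s : ℕ) :
    ∑ i ∈ range (r * s), b ^ i = (∑ i ∈ range s, b ^ i) * ∑ i ∈ range r, (b ^ s) ^ i := by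
  induction r with
  | zero => simp
  | succ r ih =>
    rw [add_mul, one_mul, sum_range_add, ih, sum_range_succ, mul_add, ← pow_mul]
    congr 1
    rw [sum_mul]
    exact sum_congr rfl fun i _ => by rw [pow_add, mul_comm, mul_comm r]

theorem log_le_of_factorial_eq {r Q k₀ : ℕ} (hr : r.Prime) (hQ : 2 ≤ Q) (hk₀ : 0 < k₀) {α γ : ℝ}
    (hα : 0 ≤ α) (h : Real.log Q + (1 + 1 / k₀) * ramifiedLog Q ≤ α * (Q - 1))
    (hγ : γ < 1) (hαγ : α * r ≤ γ * (r - 1)) {n b s : ℕ} (hn : 2 ≤ n) (hb : 2 ≤ b)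
    (heq : n.factorial = b * ∑ i ∈ range (r * s), b ^ i)
    (hsq : ¬ r ^ 2 ∣ ∑ i ∈ range r, (b ^ s) ^ i)
    (hp : ∀ p, p.Prime → p ∣ ∑ i ∈ range r, (b ^ s) ^ i → p ≠ r → p ≡ 1 [MOD Q]) :
    Real.log n ≤ (5 + 2 * psiOne Q (k₀ * Q)) / (1 - γ) := by
  set β := psiOne Q (k₀ * Q)
  set c := b ^ s with hc
  set G := ∑ i ∈ range r, c ^ i
  have hc0 : 0 < c := by positivity
  have hr2 : (2 : ℝ) ≤ r := mod_cast hr.two_le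
  have hcG : c ^ (r - 1) ≤ G :=
    single_le_sum (f := fun i => c ^ i) (fun _ _ => Nat.zero_le _)
      (mem_range.mpr (Nat.sub_lt hr.pos one_pos))
  have hG0 : G ≠ 0 := by have := pow_pos hc0 (r - 1); omega
  have hGn : G ∣ n.factorial := by
    rw [heq, geom_sum_mul_eq, ← mul_assoc]
    exact dvd_mul_left _ _
  obtain ⟨g, hg, hgG, hcase⟩ := exists_factor_modEq_one hG0 hsq hp
  have hg0 : g ≠ 0 := ne_zero_of_dvd_ne_zero hG0 hgG
  have hlog0 : 0 ≤ Real.log n := Real.log_natCast_nonneg n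
  have hlogg : Real.log G ≤ Real.log n + Real.log g := by
    rcases hcase with h1 | h1
    · rw [← h1]; linarith
    · have hrn : r ≤ n := (hr.dvd_factorial).mp ((h1 ▸ dvd_mul_right r g : r ∣ G).trans hGn)
      rw [h1, Nat.cast_mul, Real.log_mul (by linarith) (mod_cast hg0)]
      have := Real.log_le_log (by linarith : (0 : ℝ) < r) (Nat.cast_le.mpr hrn)
      linarith
  have hmain := log_le_of_dvd_factorial hQ hk₀ hα h hg (hgG.trans hGn)
  have hlogc : (r - 1) * Real.log c ≤ Real.log G := by
    have h1 : Real.log ((c ^ (r - 1) : ℕ) : ℝ) ≤ Real.log G :=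
      Real.log_le_log (by positivity) (Nat.cast_le.mpr hcG)
    rwa [Nat.cast_pow, Real.log_pow, Nat.cast_sub hr.one_le, Nat.cast_one] at h1
  have hfac : Real.log n.factorial ≤ Real.log 2 + r * Real.log c := by
    have h1 : n.factorial ≤ 2 * c ^ r := by
      rw [heq, hc, ← pow_mul, mul_comm s r]
      exact geom_sum_le b _ hb
    have h2 : Real.log n.factorial ≤ Real.log ((2 * c ^ r : ℕ) : ℝ) :=
      Real.log_le_log (by positivity) (Nat.cast_le.mpr h1)
    rwa [Nat.cast_mul, Nat.cast_pow, Real.log_mul (by norm_num) (by positivity),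
      Real.log_pow] at h2
  have hβ0 : 0 ≤ n * β := mul_nonneg (Nat.cast_nonneg _) (psiOne_nonneg _ _)
  have hX : 0 ≤ n * (1 + Real.log n) := by positivity
  refine log_le_of_log_factorial_le hn hγ ?_
  refine le_of_mul_le_mul_left ?_ (by linarith : (0 : ℝ) < r - 1)
  set X := n * (1 + Real.log n)
  have e1 := mul_le_mul_of_nonneg_left hfac (by linarith : (0 : ℝ) ≤ r - 1)
  have e2 : r * ((r - 1) * Real.log c) ≤ r * (Real.log n + (α * X + n * β)) :=
    mul_le_mul_of_nonneg_left (by linarith) (by linarith)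
  have e3 := mul_le_mul_of_nonneg_right hαγ hX
  have e4 : r * (Real.log n + n * β) ≤ 2 * (r - 1) * (Real.log n + n * β) :=
    mul_le_mul_of_nonneg_right (by linarith) (by linarith)
  linarith

theorem modEq_one_of_dvd_geom_sum {q c p : ℕ} (hq : q.Prime) (hp : p.Prime)
    (h : p ∣ ∑ i ∈ range q, c ^ i) (hpq : p ≠ q) : p ≡ 1 [MOD q] := by
  have : Fact p.Prime := ⟨hp⟩
  have : Fact q.Prime := ⟨hq⟩
  have h0 : ∑ i ∈ range q, (c : ZMod p) ^ i = 0 := by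
    have := (ZMod.natCast_eq_zero_iff _ _).mpr h
    push_cast at this
    exact this
  have h1 : (c : ZMod p) ^ q = 1 := by
    have := geom_sum_mul (c : ZMod p) q
    rw [h0, zero_mul] at this
    exact (sub_eq_zero.mp this.symm)
  have h2 : (c : ZMod p) ≠ 1 := by
    intro hc
    rw [hc] at h0
    simp only [one_pow, sum_const, card_range, nsmul_eq_mul, mul_one] at h0
    exact hpq ((Nat.prime_dvd_prime_iff_eq hp hq).mp ((ZMod.natCast_eq_zero_iff _ _).mp h0))
  have h3 : (c : ZMod p) ≠ 0 := by
    intro hc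
    rw [hc, zero_pow hq.ne_zero] at h1
    exact zero_ne_one h1
  have h4 := ZMod.orderOf_dvd_card_sub_one h3
  rw [orderOf_eq_prime h1 h2] at h4
  exact ((Nat.modEq_iff_dvd' hp.one_le).mpr h4).symm

theorem not_sq_dvd_geom_sum {q : ℕ} (c : ℕ) (hq : q.Prime) (hodd : Odd q) :
    ¬ q ^ 2 ∣ ∑ i ∈ range q, c ^ i := by
  intro h
  have : Fact q.Prime := ⟨hq⟩
  have hqZ : Prime (q : ℤ) := Nat.prime_iff_prime_int.mp hq
  have h0 : ∑ i ∈ range q, (c : ZMod q) ^ i = 0 := by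
    have := (ZMod.natCast_eq_zero_iff _ _).mpr ((dvd_pow_self q two_ne_zero).trans h)
    push_cast at this
    exact this
  have h1 : (c : ZMod q) = 1 := by
    have := geom_sum_mul (c : ZMod q) q
    rw [h0, zero_mul, ZMod.pow_card] at this
    exact (sub_eq_zero.mp this.symm)
  have h2 : (q : ℤ) ∣ c - 1 := by
    rw [← ZMod.intCast_zmod_eq_zero_iff_dvd]
    push_cast
    rw [h1, sub_self]
  have h3 : ¬ (q : ℤ) ∣ c := fun h3 =>
    hqZ.not_dvd_one (by simpa using dvd_sub h3 h2)
  have h4 := emultiplicity_geom_sum₂_eq_one hqZ hodd h2 h3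
  have h5 : ((2 : ℕ) : ℕ∞) ≤ 1 := by
    rw [← h4]
    refine le_emultiplicity_of_pow_dvd ?_
    simp only [one_pow, mul_one]
    exact_mod_cast h
  exact absurd h5 (by norm_num)

theorem modEq_one_eight_of_dvd {x p : ℕ} (hp : p.Prime) (h : p ∣ x ^ 4 + 1) (hp2 : p ≠ 2) :
    p ≡ 1 [MOD 8] := by
  have : Fact p.Prime := ⟨hp⟩
  have : Fact (2 < p) := ⟨lt_of_le_of_ne hp.two_le hp2.symm⟩
  have h0 : (x : ZMod p) ^ 4 = -1 := by
    have := (ZMod.natCast_eq_zero_iff _ _).mpr h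
    push_cast at this
    exact eq_neg_of_add_eq_zero_left this
  have h1 : orderOf (x : ZMod p) = 2 ^ (2 + 1) := by
    refine orderOf_eq_prime_pow ?_ ?_
    · norm_num [h0]
      exact ZMod.neg_one_ne_one
    · rw [show 2 ^ (2 + 1) = 4 * 2 by norm_num, pow_mul, h0]
      norm_num
  have h2 : (x : ZMod p) ≠ 0 := by
    intro hx
    rw [hx] at h0
    norm_num at h0
  have h3 := ZMod.orderOf_dvd_card_sub_one h2
  rw [h1] at h3
  exact ((Nat.modEq_iff_dvd' hp.one_le).mpr h3).symm

theorem not_four_dvd_pow_four_add_one (x : ℕ) : ¬ 2 ^ 2 ∣ x ^ 4 + 1 := by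
  intro h
  have h1 : (x : ZMod 4) ^ 4 + 1 = 0 := by
    have := (ZMod.natCast_eq_zero_iff (x ^ 4 + 1) 4).mpr h
    push_cast at this
    exact this
  revert h1
  generalize (x : ZMod 4) = y
  revert y
  decide

theorem modEq_one_six_of_dvd {c p : ℕ} (hp : p.Prime) (h : p ∣ ∑ i ∈ range 3, c ^ i)
    (hp3 : p ≠ 3) : p ≡ 1 [MOD 6] := by
  have h3 := modEq_one_of_dvd_geom_sum Nat.prime_three hp h hp3
  have h2 : p ≡ 1 [MOD 2] := by
    refine Nat.odd_iff.mp (hp.odd_of_ne_two ?_)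
    rintro rfl
    have he : Even (c * (c + 1)) := Nat.even_mul_succ_self c
    simp only [sum_range_succ, range_zero, sum_empty] at h
    rw [show 0 + c ^ 0 + c ^ 1 + c ^ 2 = c * (c + 1) + 1 by ring] at h
    have := he.two_dvd
    omega
  exact (Nat.modEq_and_modEq_iff_modEq_mul (by norm_num : Nat.Coprime 2 3)).mp ⟨h2, h3⟩

theorem log_three_le : Real.log 3 ≤ 8 / 5 * Real.log 2 := by
  have h : Real.log ((3 : ℝ) ^ 5) ≤ Real.log ((2 : ℝ) ^ 8) :=
    Real.log_le_log (by norm_num) (by norm_num)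
  rw [Real.log_pow, Real.log_pow] at h
  push_cast at h
  linarith

theorem log_five_le : Real.log 5 ≤ 7 / 3 * Real.log 2 := by
  have h : Real.log ((5 : ℝ) ^ 3) ≤ Real.log ((2 : ℝ) ^ 7) :=
    Real.log_le_log (by norm_num) (by norm_num)
  rw [Real.log_pow, Real.log_pow] at h
  push_cast at h
  linarith

theorem ramifiedLog_six : ramifiedLog 6 = Real.log 2 + Real.log 3 / 2 := by
  have : Nat.primeFactors 6 = {2, 3} := by
    rw [show 6 = 2 * 3 by norm_num, Nat.primeFactors_mul (by norm_num) (by norm_num),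
      Nat.prime_two.primeFactors, Nat.prime_three.primeFactors]
    rfl
  rw [ramifiedLog, this, sum_pair (by norm_num)]
  norm_num

theorem ramifiedLog_eight : ramifiedLog 8 = Real.log 2 := by
  rw [ramifiedLog, show 8 = 2 ^ 3 by norm_num,
    Nat.primeFactors_prime_pow (by norm_num) Nat.prime_two, sum_singleton]
  norm_num

theorem ramifiedLog_prime {q : ℕ} (hq : q.Prime) : ramifiedLog q = Real.log q / (q - 1) := by
  rw [ramifiedLog, hq.primeFactors, sum_singleton]

theorem log_add_six_le :
    Real.log (6 : ℕ) + (1 + 1 / (20 : ℕ)) * ramifiedLog 6 ≤ (63 / 100 : ℝ) * ((6 : ℕ) - 1) := by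
  have h6 : Real.log (6 : ℕ) = Real.log 2 + Real.log 3 := by
    rw [← Real.log_mul (by norm_num) (by norm_num)]
    norm_num
  rw [h6, ramifiedLog_six]
  have := log_three_le
  have := Real.log_two_lt_d9
  norm_num
  linarith

theorem log_add_eight_le :
    Real.log (8 : ℕ) + (1 + 1 / (20 : ℕ)) * ramifiedLog 8 ≤ (45 / 100 : ℝ) * ((8 : ℕ) - 1) := by
  have h8 : Real.log (8 : ℕ) = 3 * Real.log 2 := by
    rw [show ((8 : ℕ) : ℝ) = 2 ^ 3 by norm_num, Real.log_pow]
    norm_num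
  rw [h8, ramifiedLog_eight]
  have := Real.log_two_lt_d9
  norm_num
  linarith

theorem log_add_prime_le {q : ℕ} (hq : q.Prime) (h5 : 5 ≤ q) :
    Real.log q + (1 + 1 / (1 : ℕ)) * ramifiedLog q ≤
      (95 / 100 * ((q : ℝ) - 1) / q) * ((q : ℝ) - 1) := by
  have hq5 : (5 : ℝ) ≤ q := mod_cast h5
  have hlog : Real.log q ≤ q / 5 + 31 / 50 := by
    have h1 := Real.log_le_sub_one_of_pos (show (0 : ℝ) < q / 5 by positivity)
    rw [Real.log_div (by positivity) (by norm_num)] at h1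
    have := log_five_le
    have := Real.log_two_lt_d9
    linarith
  have hq1 : (0 : ℝ) < q - 1 := by linarith
  rw [ramifiedLog_prime hq, Nat.cast_one]
  have e : Real.log q + (1 + 1 / 1) * (Real.log q / ((q : ℝ) - 1)) =
      Real.log q * ((q + 1) / (q - 1)) := by
    field_simp
    ring
  rw [e]
  refine (mul_le_mul_of_nonneg_right hlog (by positivity)).trans ?_
  rw [mul_div_assoc', div_mul_eq_mul_div, div_le_div_iff₀ hq1 (by positivity)]
  obtain ⟨t, ht⟩ : ∃ t : ℝ, t = q - 5 := ⟨_, rfl⟩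
  have ht0 : 0 ≤ t := by linarith
  rw [show (q : ℝ) = t + 5 by linarith]
  nlinarith [pow_nonneg ht0 2, pow_nonneg ht0 3]

theorem exists_prime_dvd_or_eight_dvd {M : ℕ} (hM : 5 ≤ M) :
    (∃ q, q.Prime ∧ 5 ≤ q ∧ q ∣ M) ∨ 3 ∣ M ∨ 8 ∣ M := by
  rcases Nat.eq_two_pow_or_exists_odd_prime_and_dvd M with ⟨k, rfl⟩ | ⟨q, hq, hqM, hodd⟩
  · have : 3 ≤ k := by
      by_contra hk
      have : 2 ^ k ≤ 2 ^ 2 := Nat.pow_le_pow_right (by norm_num) (by omega)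
      omega
    exact Or.inr (Or.inr (pow_dvd_pow 2 this))
  · by_cases h3 : q = 3
    · exact Or.inr (Or.inl (h3 ▸ hqM))
    · have := hq.two_le
      obtain ⟨j, hj⟩ := hodd
      exact Or.inl ⟨q, hq, by omega, hqM⟩

theorem exists_bound_of_factorial_eq : ∃ B : ℝ, ∀ n b M : ℕ, 2 ≤ n → 2 ≤ b → 5 ≤ M →
    n.factorial = b * ∑ i ∈ range M, b ^ i → Real.log n ≤ B := by
  refine ⟨max (100 : ℝ) (max ((5 + 2 * psiOne 6 (20 * 6)) / (1 - 95 / 100))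
    ((5 + 2 * psiOne 8 (20 * 8)) / (1 - 95 / 100))), fun n b M hn hb hM heq => ?_⟩
  rcases exists_prime_dvd_or_eight_dvd hM with ⟨q, hq, h5, s, rfl⟩ | ⟨s, rfl⟩ | ⟨s, rfl⟩
  · have hq5 : (5 : ℝ) ≤ q := mod_cast h5
    have hα : (0 : ℝ) ≤ 95 / 100 * ((q : ℝ) - 1) / q := by
      have : (0 : ℝ) ≤ q - 1 := by linarith
      positivity
    have h := log_le_of_factorial_eq hq hq.two_le one_pos hα (log_add_prime_le hq h5)
      (by norm_num : (95 / 100 : ℝ) < 1) (by field_simp; rfl) hn hb heq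
      (not_sq_dvd_geom_sum _ hq (hq.odd_of_ne_two (by omega)))
      (fun p hp hd hpq => modEq_one_of_dvd_geom_sum hq hp hd hpq)
    rw [one_mul, psiOne_eq_zero le_rfl] at h
    refine le_trans (h.trans ?_) (le_max_left _ _)
    norm_num
  · refine le_trans ?_ ((le_max_left _ _).trans (le_max_right _ _))
    exact log_le_of_factorial_eq Nat.prime_three (by norm_num) (by norm_num) (by norm_num)
      log_add_six_le (by norm_num) (by norm_num) hn hb heq
      (not_sq_dvd_geom_sum _ Nat.prime_three (by decide))
      (fun p hp hd hpq => modEq_one_six_of_dvd hp hd hpq)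
  · refine le_trans ?_ ((le_max_right _ _).trans (le_max_right _ _))
    have hG : ∑ i ∈ range 2, (b ^ (4 * s)) ^ i = (b ^ s) ^ 4 + 1 := by
      simp only [sum_range_succ, range_zero, sum_empty]
      ring
    rw [show 8 * s = 2 * (4 * s) by ring] at heq
    refine log_le_of_factorial_eq Nat.prime_two (by norm_num) (by norm_num) (by norm_num)
      log_add_eight_le (by norm_num) (by norm_num) hn hb heq ?_ ?_
    · rw [hG]
      exact not_four_dvd_pow_four_add_one _
    · rw [hG]
      exact fun p hp hd hp2 => modEq_one_eight_of_dvd hp hd hp2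

/-- **Lemma 2 (with `m₀ = 6`).** The set of triples `(n, b, m)` of integers with
`n ≥ 2`, `b ≥ 2`, `m ≥ 6` and `n! = (b^m − 1)/(b − 1) − 1` is finite. -/
theorem lemma2_finite :
    Set.Finite {t : ℕ × ℤ × ℕ |
      2 ≤ t.1 ∧ 2 ≤ t.2.1 ∧ 6 ≤ t.2.2 ∧
      (Nat.factorial t.1 : ℤ) = (∑ i ∈ Finset.range t.2.2, t.2.1 ^ i) - 1} := by
  obtain ⟨B, hB⟩ := exists_bound_of_factorial_eq
  set N := ⌊Real.exp B⌋₊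
  refine ((Set.finite_Iic N).prod ((Set.finite_Icc (0 : ℤ) N.factorial).prod
    (Set.finite_Iic (N.factorial + 1)))).subset ?_
  rintro ⟨n, b, m⟩ ⟨hn, hb, hm, heq⟩
  simp only at hn hb hm heq
  lift b to ℕ using by omega
  obtain ⟨M, rfl⟩ : ∃ M, m = M + 1 := ⟨m - 1, by omega⟩
  have hb2 : 2 ≤ b := by exact_mod_cast hb
  have hfac : n.factorial = b * ∑ i ∈ range M, b ^ i := by
    rw [sum_range_succ', pow_zero, add_sub_cancel_right] at heq
    rw [mul_sum]
    simp only [pow_succ'] at heq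
    exact_mod_cast heq
  have hnN : n ≤ N := by
    refine Nat.le_floor ?_
    rw [← Real.log_le_iff_le_exp (by positivity)]
    exact hB n b M hn hb2 (by omega) hfac
  have hnf : n.factorial ≤ N.factorial := Nat.factorial_le hnN
  have hMsum : M ≤ ∑ i ∈ range M, b ^ i := by
    simpa using card_nsmul_le_sum (range M) (fun i => b ^ i) 1
      fun i _ => Nat.one_le_pow _ _ (by omega)
  have hbn : b ≤ n.factorial := by rw [hfac]; nlinarith
  have hMn : M ≤ n.factorial := by rw [hfac]; nlinarith
  refine ⟨hnN, ⟨Int.natCast_nonneg b, ?_⟩, ?_⟩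
  · exact Int.ofNat_le.mpr (hbn.trans hnf)
  · simp only [Set.mem_Iic]
    omega
end

section
/- Let p be a prime and let a be a positive integer divisible by p. Then the polynomial X^{p−1} + X^{p−2} + ⋯ + X + 1 + a is irreducible over ℚ. -/
open Polynomial

/-- A monic integer polynomial whose reduction modulo `p` divides a power of `X - 1` reduces to
a power of `X - 1`. -/
theorem map_zmod_eq_X_sub_one_pow {p : ℕ} [Fact p.Prime] {g : ℤ[X]} (hg : g.Monic) {n : ℕ}
    (h : g.map (Int.castRingHom (ZMod p)) ∣ (X - 1) ^ n) :
    g.map (Int.castRingHom (ZMod p)) = (X - 1) ^ g.natDegree := by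
  have hX : Monic (X - 1 : (ZMod p)[X]) := by simpa using monic_X_sub_C (1 : ZMod p)
  have hprime : Prime (X - 1 : (ZMod p)[X]) := by simpa using prime_X_sub_C (1 : ZMod p)
  obtain ⟨k, -, hk⟩ := (dvd_prime_pow hprime n).1 h
  have heq := eq_of_monic_of_associated (hg.map _) (hX.pow k) hk
  have hdeg : g.natDegree = k := by
    rw [← hg.natDegree_map (Int.castRingHom (ZMod p)), heq, hX.natDegree_pow]
    simpa using congrArg (k * ·) (natDegree_X_sub_C (1 : ZMod p))
  rw [heq, hdeg]

theorem dvd_eval_one_of_map_eq_X_sub_one_pow {p : ℕ} {g : ℤ[X]} {n : ℕ} (hn : n ≠ 0)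
    (h : g.map (Int.castRingHom (ZMod p)) = (X - 1) ^ n) : (p : ℤ) ∣ g.eval 1 := by
  rw [← ZMod.intCast_zmod_eq_zero_iff_dvd, ← eq_intCast (Int.castRingHom (ZMod p)),
    ← eval_map_apply, h]
  simp [hn]

theorem dvd_eval_one_derivative_of_map_eq_X_sub_one_pow {p : ℕ} {g : ℤ[X]} {n : ℕ} (hn : 2 ≤ n)
    (h : g.map (Int.castRingHom (ZMod p)) = (X - 1) ^ n) :
    (p : ℤ) ∣ (derivative g).eval 1 := by
  rw [← ZMod.intCast_zmod_eq_zero_iff_dvd, ← eq_intCast (Int.castRingHom (ZMod p)),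
    ← eval_map_apply, ← derivative_map, h]
  simp [derivative_pow, show n - 1 ≠ 0 by omega]

theorem two_mul_eval_one_derivative_cyclotomic_prime {p : ℕ} [Fact p.Prime] :
    2 * (derivative (cyclotomic p ℤ)).eval 1 = p * (p - 1) := by
  have h := Finset.sum_range_id_mul_two p
  zify [(Fact.out : p.Prime).one_le] at h
  simp [cyclotomic_prime, eval_finsetSum, derivative_X_pow, ← h, mul_comm]

theorem cyclotomic_add_irreducible (p : ℕ) (a : ℤ)
    (hp : Nat.Prime p) (ha : 0 < a) (hpa : (p : ℤ) ∣ a) :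
    Irreducible ((cyclotomic p ℚ) + C (a : ℚ)) := by
  have : Fact p.Prime := ⟨hp⟩
  have hdegC : (cyclotomic p ℤ).natDegree = p - 1 := by
    rw [natDegree_cyclotomic, Nat.totient_prime hp]
  have hp1 : 0 < p - 1 := Nat.sub_pos_of_lt hp.one_lt
  set f : ℤ[X] := cyclotomic p ℤ + C a with hf
  have hdeg : f.natDegree = p - 1 := by rw [hf, natDegree_add_C, hdegC]
  have hmonic : f.Monic := (cyclotomic.monic p ℤ).add_of_left <|
    degree_C_le.trans_lt <| natDegree_pos_iff_degree_pos.1 (hdegC ▸ hp1)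
  have hmap : f.map (Int.castRingHom ℚ) = cyclotomic p ℚ + C (a : ℚ) := by simp [hf]
  rw [← hmap, ← IsPrimitive.Int.irreducible_iff_irreducible_map_cast hmonic.isPrimitive,
    hmonic.irreducible_iff_natDegree]
  refine ⟨fun h => by simp [h] at hdeg; omega, fun g h hg hh hgh => ?_⟩
  by_contra! hne
  have hsum : g.natDegree + h.natDegree = p - 1 := by
    rw [← hg.natDegree_mul hh, hgh, hdeg]
  have hpos (x : ℤ) : f.eval x ≠ 0 := by
    have := cyclotomic_pos (n := p) (by omega) x
    simp only [hf, eval_add, eval_C]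
    omega
  have hone {q : ℤ[X]} (hq : q.Monic) (hqf : q ∣ f) : q.natDegree ≠ 1 := fun h1 => by
    obtain ⟨r, hr⟩ := hqf
    apply hpos (-q.coeff 0)
    rw [hr, eval_mul, hq.eq_X_add_C h1]
    simp
  have hg2 := hone hg ⟨h, hgh.symm⟩
  have hh2 := hone hh ⟨g, by rw [mul_comm, hgh]⟩
  have hfmod : f.map (Int.castRingHom (ZMod p)) = (X - 1) ^ (p - 1) := by
    have hcyc := cyclotomic_mul_prime_eq_pow_of_not_dvd (ZMod p) (n := 1) hp.not_dvd_one
    rw [one_mul, cyclotomic_one] at hcyc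
    rw [hf, Polynomial.map_add, map_cyclotomic, hcyc, map_C, eq_intCast,
      (ZMod.intCast_zmod_eq_zero_iff_dvd a p).2 hpa, C_0, add_zero]
  have hgmod := map_zmod_eq_X_sub_one_pow (p := p) hg (n := p - 1)
    (by rw [← hfmod, ← hgh, Polynomial.map_mul]; exact dvd_mul_right _ _)
  have hhmod := map_zmod_eq_X_sub_one_pow (p := p) hh (n := p - 1)
    (by rw [← hfmod, ← hgh, Polynomial.map_mul]; exact dvd_mul_left _ _)
  have hsq : (p : ℤ) * p ∣ (derivative f).eval 1 := by
    rw [← hgh, derivative_mul, eval_add, eval_mul, eval_mul]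
    exact dvd_add
      (mul_dvd_mul (dvd_eval_one_derivative_of_map_eq_X_sub_one_pow (by omega) hgmod)
        (dvd_eval_one_of_map_eq_X_sub_one_pow hne.2 hhmod))
      (mul_dvd_mul (dvd_eval_one_of_map_eq_X_sub_one_pow hne.1 hgmod)
        (dvd_eval_one_derivative_of_map_eq_X_sub_one_pow (by omega) hhmod))
  have hdvd : (p : ℤ) * p ∣ p * (p - 1) := by
    rw [← two_mul_eval_one_derivative_cyclotomic_prime]
    simpa [hf] using hsq.mul_left 2
  have hdvd' := Int.le_of_dvd (by omega)
    (Int.dvd_of_mul_dvd_mul_left (by exact_mod_cast hp.ne_zero) hdvd)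
  omega
end

section
/- Let p ≥ 7 be a prime and let a be a negative integer divisible by p. Then the polynomial Φ_p(X) + a ∈ ℤ[X] is either irreducible over ℚ, or equal to a product of a polynomial of degree 1 and a polynomial that is irreducible over ℚ. -/
open Polynomial

/-- A monic factor of degree at least two of a power of `X - 1` over `ZMod p` vanishes to order at
least two at `1`; read back in `ℤ[X]`, its value and its derivative at `1` are divisible by `p`. -/
lemma dvd_eval_one_and_derivative_of_map_dvd_pow {p n : ℕ} [Fact p.Prime] {g : ℤ[X]}
    (hg : g.Monic) (hdeg : 2 ≤ g.natDegree)
    (hdvd : g.map (Int.castRingHom (ZMod p)) ∣ (X - C 1) ^ n) :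
    (p : ℤ) ∣ g.eval 1 ∧ (p : ℤ) ∣ (derivative g).eval 1 := by
  obtain ⟨k, -, hk⟩ := (dvd_prime_pow (prime_X_sub_C (1 : ZMod p)) n).1 hdvd
  have hgk : g.map (Int.castRingHom (ZMod p)) = (X - C 1) ^ k :=
    eq_of_monic_of_associated (hg.map _) ((monic_X_sub_C 1).pow k) hk
  have hk2 : 2 ≤ k := by
    have h := congrArg natDegree hgk
    rw [hg.natDegree_map, natDegree_pow, natDegree_X_sub_C, mul_one] at h
    lia
  constructor
  · rw [← ZMod.intCast_zmod_eq_zero_iff_dvd]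
    have h := congrArg (eval 1) hgk
    rw [eval_one_map] at h
    simpa [show k ≠ 0 by lia] using h
  · rw [← ZMod.intCast_zmod_eq_zero_iff_dvd]
    have h := congrArg (fun q => eval 1 (derivative q)) hgk
    simp only [derivative_map, eval_one_map, derivative_X_sub_C_pow] at h
    simpa [show k - 1 ≠ 0 by lia] using h

lemma two_mul_eval_one_derivative_cyclotomic {p : ℕ} [Fact p.Prime] :
    (derivative (cyclotomic p ℤ)).eval 1 * 2 = (p : ℤ) * (p - 1) := by
  have hp := (Fact.out : p.Prime).one_le
  have h := congrArg (Nat.cast : ℕ → ℤ) (Finset.sum_range_id_mul_two p)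
  push_cast [hp] at h
  rw [← h, cyclotomic_prime]
  simp [eval_finsetSum, derivative_X_pow]

lemma monic_cyclotomic_add_C {p : ℕ} (hp : p.Prime) (a : ℤ) : (cyclotomic p ℤ + C a).Monic := by
  refine (cyclotomic.monic p ℤ).add_of_left (degree_C_le.trans_lt ?_)
  rw [degree_cyclotomic, Nat.totient_prime hp]
  exact_mod_cast Nat.sub_pos_of_lt hp.one_lt

lemma natDegree_le_one_of_mul_eq_cyclotomic_add_C {p : ℕ} [Fact p.Prime] {a : ℤ}
    (hpa : (p : ℤ) ∣ a) {g h : ℤ[X]} (hg : g.Monic) (hh : h.Monic)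
    (hgh : g * h = cyclotomic p ℤ + C a) : g.natDegree ≤ 1 ∨ h.natDegree ≤ 1 := by
  have hp : p.Prime := Fact.out
  by_contra! hdeg
  have hmap : g.map (Int.castRingHom (ZMod p)) * h.map (Int.castRingHom (ZMod p)) =
      (X - C 1) ^ (p - 1) := by
    have hcyc := cyclotomic_mul_prime_eq_pow_of_not_dvd (ZMod p) (n := 1) hp.not_dvd_one
    rw [one_mul, cyclotomic_one] at hcyc
    rw [← Polynomial.map_mul, hgh, Polynomial.map_add, map_cyclotomic, map_C, eq_intCast,
      (ZMod.intCast_zmod_eq_zero_iff_dvd a p).2 hpa, hcyc, C_0, add_zero, C_1]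
  obtain ⟨⟨u, hu⟩, v, hv⟩ :=
    dvd_eval_one_and_derivative_of_map_dvd_pow hg hdeg.1 (Dvd.intro _ hmap)
  obtain ⟨⟨w, hw⟩, z, hz⟩ :=
    dvd_eval_one_and_derivative_of_map_dvd_pow hh hdeg.2 (Dvd.intro_left _ hmap)
  have hder := congrArg (fun q => eval 1 (derivative q)) hgh
  simp only [derivative_mul, derivative_add, derivative_C, add_zero, eval_add, eval_mul,
    hu, hv, hw, hz] at hder
  have hval := two_mul_eval_one_derivative_cyclotomic (p := p)
  rw [← hder] at hval
  have hp0 : (p : ℤ) ≠ 0 := by exact_mod_cast hp.ne_zero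
  have hcancel : (p : ℤ) * ((v * w + u * z) * 2) = p - 1 :=
    mul_left_cancel₀ hp0 (by linear_combination hval)
  have hone : (p : ℤ) ∣ 1 := ⟨1 - (v * w + u * z) * 2, by linear_combination hcancel⟩
  exact hp.not_dvd_one (by exact_mod_cast hone)

lemma irreducible_of_mul_eq_cyclotomic_add_C {p : ℕ} [Fact p.Prime] (hp : 5 ≤ p) {a : ℤ}
    (hpa : (p : ℤ) ∣ a) {l q : ℤ[X]} (hl : l.Monic) (hq : q.Monic) (hdeg : l.natDegree = 1)
    (hlq : l * q = cyclotomic p ℤ + C a) : Irreducible q := by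
  have hnat := congrArg natDegree hlq
  rw [hl.natDegree_mul hq, natDegree_add_C, natDegree_cyclotomic,
    Nat.totient_prime Fact.out] at hnat
  have hq1 : q ≠ 1 := by
    rintro rfl
    rw [natDegree_one] at hnat
    lia
  rw [irreducible_of_monic hq hq1]
  intro u v hu hv huv
  have h₁ := natDegree_le_one_of_mul_eq_cyclotomic_add_C hpa (hl.mul hu) hv
    (by rw [mul_assoc, huv, hlq])
  have h₂ := natDegree_le_one_of_mul_eq_cyclotomic_add_C hpa (hl.mul hv) hu
    (by rw [mul_assoc, mul_comm v, huv, hlq])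
  rw [hl.natDegree_mul hu] at h₁
  rw [hl.natDegree_mul hv] at h₂
  rw [← huv, hu.natDegree_mul hv] at hnat
  rw [← hu.natDegree_eq_zero, ← hv.natDegree_eq_zero]
  lia

/-- Let `p ≥ 7` be a prime and `a` a negative integer divisible by `p`. Then
`Φ_p(X) + a ∈ ℤ[X]` is either irreducible over `ℚ`, or a product of a polynomial
of degree 1 and a polynomial irreducible over `ℚ`. -/
theorem cyclotomic_add_neg_factorization (p : ℕ) (a : ℤ)
    (hp : Nat.Prime p) (hp7 : 7 ≤ p) (ha : a < 0) (hpa : (p : ℤ) ∣ a) :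
    Irreducible ((cyclotomic p ℚ) + C (a : ℚ)) ∨
      ∃ L Q : ℤ[X], L.degree = 1 ∧ Irreducible (Q.map (Int.castRingHom ℚ)) ∧
        (cyclotomic p ℤ) + C a = L * Q := by
  have : Fact p.Prime := ⟨hp⟩
  have hp5 : 5 ≤ p := by lia
  have hf := monic_cyclotomic_add_C hp a
  have hmap : (cyclotomic p ℤ + C a).map (algebraMap ℤ ℚ) = cyclotomic p ℚ + C (a : ℚ) := by
    simp
  rw [← hmap, ← hf.irreducible_iff_irreducible_map_fraction_map]
  refine or_iff_not_imp_left.2 fun hirr => ?_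
  have hf1 : cyclotomic p ℤ + C a ≠ 1 := by
    intro h
    have hnat := congrArg natDegree h
    rw [natDegree_add_C, natDegree_cyclotomic, Nat.totient_prime hp, natDegree_one] at hnat
    lia
  rw [irreducible_of_monic hf hf1] at hirr
  push Not at hirr
  obtain ⟨g, h, hg, hh, hgh, hg1, hh1⟩ := hirr
  rw [Ne, ← hg.natDegree_eq_zero] at hg1
  rw [Ne, ← hh.natDegree_eq_zero] at hh1
  have linear_factor {l q : ℤ[X]} (hl : l.Monic) (hq : q.Monic) (hdeg : l.natDegree = 1)
      (hlq : l * q = cyclotomic p ℤ + C a) :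
      ∃ L Q : ℤ[X], L.degree = 1 ∧ Irreducible (Q.map (Int.castRingHom ℚ)) ∧
        (cyclotomic p ℤ) + C a = L * Q :=
    ⟨l, q, (degree_eq_iff_natDegree_eq_of_pos one_pos).2 hdeg,
      (hq.irreducible_iff_irreducible_map_fraction_map (K := ℚ)).1
        (irreducible_of_mul_eq_cyclotomic_add_C hp5 hpa hl hq hdeg hlq), hlq.symm⟩
  rcases natDegree_le_one_of_mul_eq_cyclotomic_add_C hpa hg hh hgh with hdeg | hdeg
  · exact linear_factor hg hh (by lia) hgh
  · exact linear_factor hh hg (by lia) (by rw [mul_comm, hgh])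
end

section
/- Let p ≥ 7 be a prime. Then Φ_p(X) − p = (X − 1)·Q(X) for a polynomial Q(X) ∈ ℤ[X] of degree p − 2 that is irreducible over ℚ. -/
open Polynomial

/-- The quotient `((X + 1) ^ p - 1 - p * X) / X ^ 2`. -/
noncomputable def shiftedQuotient (p : ℕ) : ℤ[X] := ((X + 1) ^ p : ℤ[X]).divX.divX

theorem coeff_shiftedQuotient (p k : ℕ) :
    (shiftedQuotient p).coeff k = (p.choose (k + 2) : ℤ) := by
  simp [shiftedQuotient, coeff_divX, coeff_X_add_one_pow]

theorem X_sq_mul_shiftedQuotient (p : ℕ) :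
    (X : ℤ[X]) ^ 2 * shiftedQuotient p = (X + 1) ^ p - 1 - C (p : ℤ) * X := by
  have h₁ := divX_mul_X_add ((X + 1) ^ p : ℤ[X])
  have h₂ := divX_mul_X_add ((X + 1) ^ p : ℤ[X]).divX
  rw [coeff_X_add_one_pow] at h₁
  rw [coeff_divX, coeff_X_add_one_pow] at h₂
  simp only [Nat.choose_zero_right, Nat.cast_one, C_1, zero_add, Nat.choose_one_right] at h₁ h₂
  rw [shiftedQuotient]
  linear_combination h₁ + X * h₂

theorem natDegree_shiftedQuotient {p : ℕ} (hp : 2 ≤ p) :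
    (shiftedQuotient p).natDegree = p - 2 := by
  refine natDegree_eq_of_le_of_coeff_ne_zero ?_ ?_
  · rw [natDegree_le_iff_coeff_eq_zero]
    intro k hk
    rw [coeff_shiftedQuotient, Nat.choose_eq_zero_of_lt (by lia), Nat.cast_zero]
  · simp [coeff_shiftedQuotient, Nat.sub_add_cancel hp]

theorem monic_shiftedQuotient {p : ℕ} (hp : 2 ≤ p) : (shiftedQuotient p).Monic := by
  simp [Monic, leadingCoeff, natDegree_shiftedQuotient hp, coeff_shiftedQuotient,
    Nat.sub_add_cancel hp]

theorem irreducible_shiftedQuotient {p : ℕ} (hp : p.Prime) (hp3 : 3 ≤ p) :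
    Irreducible (shiftedQuotient p) := by
  have hdeg := natDegree_shiftedQuotient hp.two_le
  have hmonic := monic_shiftedQuotient hp.two_le
  have hprime : (Ideal.span {(p : ℤ)}).IsPrime :=
    (Ideal.span_singleton_prime (by exact_mod_cast hp.ne_zero)).2 (Nat.prime_iff_prime_int.1 hp)
  have heis : (shiftedQuotient p).IsEisensteinAt (Ideal.span {(p : ℤ)}) := by
    refine hmonic.isEisensteinAt_of_mem_of_notMem hprime.ne_top (fun {k} hk => ?_) ?_
    · rw [coeff_shiftedQuotient, Ideal.mem_span_singleton, Int.natCast_dvd_natCast]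
      exact hp.dvd_choose_self (by lia) (by lia)
    · rw [coeff_shiftedQuotient, Ideal.span_singleton_pow, Ideal.mem_span_singleton]
      intro h
      have h' : p ^ 2 ∣ p.choose 2 := by exact_mod_cast h
      have hlt : p.choose 2 < p ^ 2 := by
        rw [Nat.choose_two_right]
        have : p * (p - 1) < p ^ 2 := by
          rw [sq]; exact Nat.mul_lt_mul_of_pos_left (by lia) (by lia)
        exact (Nat.div_le_self _ _).trans_lt this
      exact absurd (Nat.le_of_dvd (Nat.choose_pos hp.two_le) h') (by lia)
  exact heis.irreducible hprime hmonic.isPrimitive (by lia)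

/-- Let `p ≥ 7` be a prime. Then `Φ_p(X) − p = (X − 1)·Q(X)` for a polynomial
`Q(X) ∈ ℤ[X]` of degree `p − 2` that is irreducible over `ℚ`. -/
theorem cyclotomic_sub_p_factorization (p : ℕ) (hp : Nat.Prime p) (hp7 : 7 ≤ p) :
    ∃ Q : ℤ[X], (cyclotomic p ℤ) - C (p : ℤ) = (X - C 1) * Q ∧
      Q.degree = (p - 2 : ℕ) ∧ Irreducible (Q.map (Int.castRingHom ℚ)) := by
  have : Fact p.Prime := ⟨hp⟩
  have hmonic := (monic_shiftedQuotient hp.two_le).comp_X_sub_C 1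
  refine ⟨(shiftedQuotient p).comp (X - C 1), ?_, ?_, ?_⟩
  · refine mul_right_cancel₀ (X_sub_C_ne_zero (1 : ℤ)) ?_
    have h := congrArg (fun f : ℤ[X] => f.comp (X - C 1)) (X_sq_mul_shiftedQuotient p)
    have hcyc := cyclotomic_prime_mul_X_sub_one ℤ p
    simp only [mul_comp, sub_comp, pow_comp, add_comp, X_comp, C_comp, one_comp, C_1,
      sub_add_cancel] at h ⊢
    linear_combination hcyc - h
  · rw [degree_eq_natDegree hmonic.ne_zero, natDegree_comp, natDegree_X_sub_C, mul_one,
      natDegree_shiftedQuotient hp.two_le]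
  · have hirr : Irreducible ((shiftedQuotient p).comp (X - C 1)) := by
      have := (MulEquiv.irreducible_iff (algEquivAevalXAddC (-1 : ℤ))).2
        (irreducible_shiftedQuotient hp (by lia))
      simpa [comp, aeval_def, sub_eq_add_neg] using this
    exact (IsPrimitive.Int.irreducible_iff_irreducible_map_cast hmonic.isPrimitive).1 hirr
end

section
/- Let b ≥ 2 and m′ ≥ 1 be integers. Then ν₂( b·(b^{m′} − 1)/(b − 1) ) ≤ ν₂( b(b+1) ) + ν₂(m′), where ν₂(k) denotes the exponent of 2 in the prime factorization of the positive integer k. -/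
lemma Nat.odd_geom_sum_of_even {b m : ℕ} (hb : Even b) (hm : m ≠ 0) :
    Odd (∑ i ∈ Finset.range m, b ^ i) := by
  obtain ⟨k, rfl⟩ := Nat.exists_eq_succ_of_ne_zero hm
  rw [Nat.succ_eq_add_one, geom_sum_succ]
  exact (hb.mul_right _).add_one

lemma Nat.odd_geom_sum_iff_of_odd {b m : ℕ} (hb : Odd b) :
    Odd (∑ i ∈ Finset.range m, b ^ i) ↔ Odd m := by
  rw [Finset.odd_sum_iff_odd_card_odd, Finset.filter_true_of_mem fun _ _ => hb.pow,
    Finset.card_range]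

lemma padicValNat_two_geom_sum_add_one {b m : ℕ} (hb : 2 ≤ b) (hb_odd : Odd b) (hm : m ≠ 0)
    (hm_even : Even m) :
    padicValNat 2 (∑ i ∈ Finset.range m, b ^ i) + 1 =
      padicValNat 2 (b + 1) + padicValNat 2 m := by
  have hsum : ∑ i ∈ Finset.range m, b ^ i ≠ 0 := (geom_sum_pos b.zero_le hm).ne'
  have hlte := padicValNat.pow_two_sub_pow (x := b) (y := 1) (by omega)
    (by obtain ⟨k, rfl⟩ := hb_odd; simp) hb_odd.not_two_dvd_nat hm hm_even
  have hgeom : (∑ i ∈ Finset.range m, b ^ i) * (b - 1) = b ^ m - 1 ^ m := by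
    rw [one_pow, geom_sum_mul_of_one_le (by omega)]
  rw [← hgeom, padicValNat.mul hsum (by omega)] at hlte
  omega

/-- Let `b ≥ 2` and `m′ ≥ 1` be integers. Then
`ν₂(b·(b^{m′} − 1)/(b − 1)) ≤ ν₂(b(b+1)) + ν₂(m′)`. -/
theorem two_adic_valuation_repunit (b m' : ℕ) (hb : 2 ≤ b) (hm : 1 ≤ m') :
    padicValNat 2 (b * ∑ i ∈ Finset.range m', b ^ i) ≤
      padicValNat 2 (b * (b + 1)) + padicValNat 2 m' := by
  have hsum : ∑ i ∈ Finset.range m', b ^ i ≠ 0 := (geom_sum_pos b.zero_le (by omega)).ne'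
  rw [padicValNat.mul (by omega) hsum, padicValNat.mul (by omega) (by omega)]
  by_cases hodd : Odd (∑ i ∈ Finset.range m', b ^ i)
  · rw [padicValNat.eq_zero_of_not_dvd hodd.not_two_dvd_nat]
    omega
  · have hb_odd : Odd b := by
      by_contra h
      exact hodd (Nat.odd_geom_sum_of_even (Nat.not_odd_iff_even.mp h) (by omega))
    rw [Nat.odd_geom_sum_iff_of_odd hb_odd, Nat.not_odd_iff_even] at hodd
    have := padicValNat_two_geom_sum_add_one hb hb_odd (by omega) hodd
    omega
end
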